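/- Let L be an even unimodular lattice and M ⊆ L a primitive submodule on which the bilinear form is nondegenerate, with orthogonal complement M^⊥. Let λ : D_M → D_{M^⊥} be a group isomorphism such that λ([x]) = [y] whenever x ∈ M^∨, y ∈ (M^⊥)^∨ and x + y ∈ L. Then for any isometries γ_M of M and γ' of M^⊥, the ℚ-linear map (γ_M ⊗ ℚ) ⊕ (γ' ⊗ ℚ) on L ⊗ ℚ maps L bijectively onto L if and only if λ ∘ r_M(γ_M) = r_{M^⊥}(γ') ∘ λ as automorphisms from D_M to D_{M^⊥}. -/

import Mathlib

open Submodule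

/-- The orthogonal complement `M^⊥ = {l ∈ L : ⟨l, m⟩ = 0 for all m ∈ M}` of a
submodule `M` of a lattice `L`, with respect to a bilinear form `Φ`. -/
def perpLat {V : Type} [AddCommGroup V] [Module ℚ V]
    (Φ : V →ₗ[ℚ] V →ₗ[ℚ] ℚ) (L M : Submodule ℤ V) : Submodule ℤ V where
  carrier := {x | x ∈ L ∧ ∀ m ∈ M, Φ x m = 0}
  zero_mem' := ⟨L.zero_mem, fun m _ => by simp⟩
  add_mem' := by
    rintro x y ⟨hxL, hx⟩ ⟨hyL, hy⟩
    refine ⟨L.add_mem hxL hyL, fun m hm => ?_⟩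
    simp [hx m hm, hy m hm]
  smul_mem' := by
    rintro c x ⟨hxL, hx⟩
    refine ⟨L.smul_mem c hxL, fun m hm => ?_⟩
    rw [← Int.cast_smul_eq_zsmul ℚ c x, map_smul]
    simp [hx m hm]

/-- The dual lattice `M^∨ = {x ∈ M ⊗ ℚ : ⟨x, m⟩ ∈ ℤ for all m ∈ M}` of a
`ℤ`-submodule `M` of a `ℚ`-vector space, with respect to a bilinear form `Φ`. -/
def dualLat {V : Type} [AddCommGroup V] [Module ℚ V]
    (Φ : V →ₗ[ℚ] V →ₗ[ℚ] ℚ) (M : Submodule ℤ V) : Submodule ℤ V where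
  carrier := {x | x ∈ span ℚ (M : Set V) ∧ ∀ m ∈ M, ∃ k : ℤ, Φ x m = (k : ℚ)}
  zero_mem' := ⟨zero_mem _, fun m _ => ⟨0, by simp⟩⟩
  add_mem' := by
    rintro x y ⟨hxs, hx⟩ ⟨hys, hy⟩
    refine ⟨add_mem hxs hys, fun m hm => ?_⟩
    obtain ⟨k, hk⟩ := hx m hm
    obtain ⟨k', hk'⟩ := hy m hm
    refine ⟨k + k', ?_⟩
    rw [map_add, LinearMap.add_apply, hk, hk']
    push_cast
    ring
  smul_mem' := by
    rintro c x ⟨hxs, hx⟩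
    refine ⟨?_, fun m hm => ?_⟩
    · rw [← Int.cast_smul_eq_zsmul ℚ c x]
      exact Submodule.smul_mem _ _ hxs
    · obtain ⟨k, hk⟩ := hx m hm
      refine ⟨c * k, ?_⟩
      rw [← Int.cast_smul_eq_zsmul ℚ c x, map_smul, LinearMap.smul_apply, smul_eq_mul, hk]
      push_cast
      ring

/-- The discriminant group `D_M = M^∨ / M`. -/
abbrev discGroup {V : Type} [AddCommGroup V] [Module ℚ V]
    (Φ : V →ₗ[ℚ] V →ₗ[ℚ] ℚ) (M : Submodule ℤ V) : Type :=
  (dualLat Φ M) ⧸ (M.comap (dualLat Φ M).subtype)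

/-- The class of `x ∈ M^∨` in the discriminant group `D_M`. -/
def discMk {V : Type} [AddCommGroup V] [Module ℚ V]
    (Φ : V →ₗ[ℚ] V →ₗ[ℚ] ℚ) (M : Submodule ℤ V) (x : dualLat Φ M) : discGroup Φ M :=
  Submodule.Quotient.mk x

/-- A primitive submodule of a finitely generated lattice is a retract of it. -/
theorem exists_retraction {V : Type} [AddCommGroup V] {L M : Submodule ℤ V} (hfg : L.FG)
    (hprim : ∀ x ∈ L, ∀ c : ℤ, c ≠ 0 → c • x ∈ M → x ∈ M) :
    ∃ p : L →ₗ[ℤ] V, (∀ z, p z ∈ M) ∧ ∀ z : L, (z : V) ∈ M → p z = z := by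
  have : Module.Finite ℤ L := Module.Finite.iff_fg.mpr hfg
  let N : Submodule ℤ L := M.comap L.subtype
  have : Module.IsTorsionFree ℤ (L ⧸ N) := by
    refine .of_smul_eq_zero fun c q h => ?_
    obtain ⟨z, rfl⟩ := N.mkQ_surjective q
    rw [or_iff_not_imp_left]
    intro hc
    rw [← map_smul] at h
    simp only [Submodule.mkQ_apply, Submodule.Quotient.mk_eq_zero] at h ⊢
    exact hprim z z.2 c hc h
  obtain ⟨s, hs⟩ := Module.projective_lifting_property N.mkQ LinearMap.id N.mkQ_surjective
  refine ⟨L.subtype ∘ₗ (LinearMap.id - s ∘ₗ N.mkQ), fun z => ?_, fun z hz => ?_⟩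
  · have : z - s (N.mkQ z) ∈ N := by
      rw [← Submodule.Quotient.mk_eq_zero, ← Submodule.mkQ_apply, map_sub, sub_eq_zero]
      exact (LinearMap.congr_fun hs (N.mkQ z)).symm
    exact this
  · have : N.mkQ z = 0 := (Submodule.Quotient.mk_eq_zero N).mpr hz
    simp [this]

section Lattice

variable {V : Type} [AddCommGroup V] [Module ℚ V]

/-- An integral functional on a finitely generated `ℤ`-submodule of a rational vector space
extends to a rational functional on the whole space. -/
theorem exists_rat_extension {L : Submodule ℤ V} (hfg : L.FG) (f : L →ₗ[ℤ] ℚ) :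
    ∃ F : V →ₗ[ℚ] ℚ, ∀ z : L, F z = f z := by
  have : Module.Finite ℤ L := Module.Finite.iff_fg.mpr hfg
  have : IsAddTorsionFree V := .of_module_rat V
  let b := Module.Free.chooseBasis ℤ L
  have hb : LinearIndependent ℚ (fun i => (b i : V)) := by
    rw [← LinearIndependent.iff_fractionRing ℤ ℚ]
    exact b.linearIndependent.map' L.subtype (Submodule.ker_subtype L)
  obtain ⟨F, hF⟩ := LinearMap.exists_extend ((Module.Basis.span hb).constr ℚ (fun i => f (b i)))
  refine ⟨F, fun z => ?_⟩
  have key : F.restrictScalars ℤ ∘ₗ L.subtype = f := by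
    refine b.ext fun i => ?_
    have h := LinearMap.congr_fun hF (Module.Basis.span hb i)
    rw [Module.Basis.constr_basis] at h
    rw [← h]
    simp [Module.Basis.span_apply]
  exact LinearMap.congr_fun key z

/-- If `L` spans `V` rationally, every vector has a nonzero integral multiple in `L`. -/
theorem exists_zsmul_mem {L : Submodule ℤ V} (hspan : span ℚ (L : Set V) = ⊤) (v : V) :
    ∃ n : ℤ, n ≠ 0 ∧ n • v ∈ L := by
  have hv : v ∈ span ℚ (L : Set V) := hspan ▸ mem_top
  induction hv using Submodule.span_induction with
  | mem x hx => exact ⟨1, one_ne_zero, by simpa using hx⟩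
  | zero => exact ⟨1, one_ne_zero, by simp⟩
  | add x y _ _ hx hy =>
    obtain ⟨m, hm, hmx⟩ := hx
    obtain ⟨n, hn, hny⟩ := hy
    refine ⟨m * n, mul_ne_zero hm hn, ?_⟩
    rw [smul_add]
    refine L.add_mem ?_ ?_
    · rw [mul_comm, mul_smul]
      exact L.smul_mem n hmx
    · rw [mul_smul]
      exact L.smul_mem m hny
  | smul q x _ hx =>
    obtain ⟨n, hn, hnx⟩ := hx
    refine ⟨q.den * n, mul_ne_zero (by exact_mod_cast q.den_ne_zero) hn, ?_⟩
    have : ((q.den : ℤ) * n) • q • x = q.num • n • x := by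
      simp only [← Int.cast_smul_eq_zsmul ℚ, smul_smul]
      congr 1
      push_cast
      linear_combination (n : ℚ) * Rat.mul_den_eq_num q
    rw [this]
    exact L.smul_mem _ hnx

/-- A nondegenerate form on a finite-dimensional subspace represents every functional. -/
theorem exists_represent [FiniteDimensional ℚ V] (Φ : V →ₗ[ℚ] V →ₗ[ℚ] ℚ) (W : Submodule ℚ V)
    (hW : ∀ x ∈ W, (∀ y ∈ W, Φ x y = 0) → x = 0) (F : V →ₗ[ℚ] ℚ) :
    ∃ w ∈ W, ∀ y ∈ W, Φ w y = F y := by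
  have hinj : Function.Injective (Φ.domRestrict₁₂ W W) := by
    rw [injective_iff_map_eq_zero]
    intro x hx
    exact Subtype.ext (hW x x.2 fun y hy => LinearMap.congr_fun hx ⟨y, hy⟩)
  have hsurj := (LinearMap.injective_iff_surjective_of_finrank_eq_finrank
    (Subspace.dual_finrank_eq (K := ℚ) (V := W)).symm).mp hinj
  obtain ⟨w, hw⟩ := hsurj (F.domRestrict W)
  exact ⟨w, w.2, fun y hy => LinearMap.congr_fun hw ⟨y, hy⟩⟩

/-- A vector of `V` orthogonal to `M` is a rational combination of `M^⊥`. -/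
theorem mem_span_perpLat (Φ : V →ₗ[ℚ] V →ₗ[ℚ] ℚ) {L M : Submodule ℤ V}
    (hspan : span ℚ (L : Set V) = ⊤) {v : V} (hv : ∀ m ∈ M, Φ v m = 0) :
    v ∈ span ℚ (perpLat Φ L M : Set V) := by
  obtain ⟨n, hn, hnv⟩ := exists_zsmul_mem hspan v
  have hmem : n • v ∈ perpLat Φ L M := by
    refine ⟨hnv, fun m hm => ?_⟩
    rw [← Int.cast_smul_eq_zsmul ℚ, map_smul, LinearMap.smul_apply, hv m hm, smul_zero]
  have : v = (n : ℚ)⁻¹ • (n • v) := by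
    rw [← Int.cast_smul_eq_zsmul ℚ, inv_smul_smul₀ (Int.cast_ne_zero.mpr hn)]
  rw [this]
  exact Submodule.smul_mem _ _ (subset_span hmem)

theorem apply_eq_zero_of_mem_span (Φ : V →ₗ[ℚ] V →ₗ[ℚ] ℚ) {M : Submodule ℤ V} {v x : V}
    (hv : ∀ m ∈ M, Φ v m = 0) (hx : x ∈ span ℚ (M : Set V)) : Φ v x = 0 := by
  have : span ℚ (M : Set V) ≤ LinearMap.ker (Φ v) := span_le.mpr hv
  exact this hx

/-- Every vector of an integral lattice is the sum of a vector of `M^∨` and one of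
`(M^⊥)^∨`, if the form is nondegenerate on `M`. -/
theorem exists_dualLat_add_dualLat [FiniteDimensional ℚ V] (Φ : V →ₗ[ℚ] V →ₗ[ℚ] ℚ)
    (hsymm : ∀ x y : V, Φ x y = Φ y x) {L M : Submodule ℤ V}
    (hspan : span ℚ (L : Set V) = ⊤)
    (hint : ∀ x ∈ L, ∀ y ∈ L, ∃ k : ℤ, Φ x y = k) (hML : M ≤ L)
    (hMnd : ∀ x ∈ span ℚ (M : Set V), (∀ y ∈ span ℚ (M : Set V), Φ x y = 0) → x = 0)
    {l : V} (hl : l ∈ L) :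
    ∃ x ∈ dualLat Φ M, ∃ y ∈ dualLat Φ (perpLat Φ L M), x + y = l := by
  obtain ⟨x, hx, hxl⟩ := exists_represent Φ (span ℚ (M : Set V)) hMnd (Φ l)
  have hperp : ∀ m ∈ M, Φ (l - x) m = 0 := fun m hm => by
    rw [map_sub, LinearMap.sub_apply, hxl m (subset_span hm), sub_self]
  refine ⟨x, ⟨hx, fun m hm => ?_⟩, l - x, ⟨mem_span_perpLat Φ hspan hperp, fun p hp => ?_⟩,
    add_sub_cancel x l⟩
  · rw [hxl m (subset_span hm)]
    exact hint l hl m (hML hm)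
  · rw [map_sub, LinearMap.sub_apply, hsymm x p, apply_eq_zero_of_mem_span Φ hp.2 hx, sub_zero]
    exact hint l hl p hp.1

/-- For a primitive submodule `M` of a unimodular lattice `L`, every vector of `M^∨` is
completed to a vector of `L` by some vector of `(M^⊥)^∨`. -/
theorem exists_dualLat_perpLat_add_mem [FiniteDimensional ℚ V] (Φ : V →ₗ[ℚ] V →ₗ[ℚ] ℚ)
    (hsymm : ∀ x y : V, Φ x y = Φ y x) (hnd : ∀ x : V, (∀ y : V, Φ x y = 0) → x = 0)
    {L M : Submodule ℤ V} (hfg : L.FG) (hspan : span ℚ (L : Set V) = ⊤)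
    (hunimod : ∀ x : V, (∀ y ∈ L, ∃ k : ℤ, Φ x y = (k : ℚ)) ↔ x ∈ L) (hML : M ≤ L)
    (hprim : ∀ x ∈ L, ∀ c : ℤ, c ≠ 0 → c • x ∈ M → x ∈ M)
    {x : V} (hx : x ∈ dualLat Φ M) :
    ∃ y ∈ dualLat Φ (perpLat Φ L M), x + y ∈ L := by
  obtain ⟨p, hpM, hp⟩ := exists_retraction hfg hprim
  obtain ⟨F, hF⟩ := exists_rat_extension hfg ((Φ x).restrictScalars ℤ ∘ₗ p)
  obtain ⟨l, -, hl⟩ := exists_represent Φ ⊤ (fun x _ h => hnd x fun y => h y mem_top) F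
  have hlL : l ∈ L := (hunimod l).mp fun y hy => by
    rw [hl y mem_top, hF ⟨y, hy⟩]
    exact hx.2 _ (hpM _)
  have hperp : ∀ m ∈ M, Φ (l - x) m = 0 := fun m hm => by
    rw [map_sub, LinearMap.sub_apply, hl m mem_top, hF ⟨m, hML hm⟩, LinearMap.comp_apply,
      hp ⟨m, hML hm⟩ hm]
    exact sub_self _
  refine ⟨l - x, ⟨mem_span_perpLat Φ hspan hperp, fun q hq => ?_⟩, ?_⟩
  · rw [map_sub, LinearMap.sub_apply, hsymm x q, apply_eq_zero_of_mem_span Φ hq.2 hx.1, sub_zero]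
    exact (hunimod l).mpr hlL q hq.1
  · rwa [add_sub_cancel]

/-- An isometry preserving `M` preserves `M^∨`. -/
theorem map_mem_dualLat (Φ : V →ₗ[ℚ] V →ₗ[ℚ] ℚ) {M : Submodule ℤ V} (g : V ≃ₗ[ℚ] V)
    (hgM : (g : V → V) '' (M : Set V) = (M : Set V))
    (hgΦ : ∀ x y : V, Φ (g x) (g y) = Φ x y) {x : V} (hx : x ∈ dualLat Φ M) :
    g x ∈ dualLat Φ M := by
  refine ⟨?_, fun m hm => ?_⟩
  · have h : g x ∈ (span ℚ (M : Set V)).map (g : V →ₗ[ℚ] V) := mem_map_of_mem hx.1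
    rwa [map_span, LinearEquiv.coe_coe, hgM] at h
  · obtain ⟨m', hm', rfl⟩ := hgM.ge hm
    rw [hgΦ]
    exact hx.2 m' hm'

end Lattice

/-- Nikulin: let `L` be an even unimodular lattice, `M ≤ L` primitive
with the form nondegenerate on `M`, and `λ : D_M ≃ D_{M^⊥}` the natural isomorphism
(`λ[x] = [y]` whenever `x ∈ M^∨`, `y ∈ (M^⊥)^∨` and `x + y ∈ L`).  An isometry
`g = (γ_M ⊗ ℚ) ⊕ (γ' ⊗ ℚ)` of `L ⊗ ℚ` built from isometries `γ_M` of `M` and `γ'`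
of `M^⊥` maps `L` bijectively onto `L` iff `λ ∘ r_M(γ_M) = r_{M^⊥}(γ') ∘ λ`. -/
theorem stmt_2
    {V : Type} [AddCommGroup V] [Module ℚ V] [FiniteDimensional ℚ V]
    (Φ : V →ₗ[ℚ] V →ₗ[ℚ] ℚ)
    (hsymm : ∀ x y : V, Φ x y = Φ y x)
    (hnd : ∀ x : V, (∀ y : V, Φ x y = 0) → x = 0)
    (L : Submodule ℤ V) (hfg : L.FG)
    (hspan : span ℚ (L : Set V) = ⊤)
    (heven : ∀ x ∈ L, ∃ k : ℤ, Φ x x = 2 * (k : ℚ))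
    (hunimod : ∀ x : V, (∀ y ∈ L, ∃ k : ℤ, Φ x y = (k : ℚ)) ↔ x ∈ L)
    (M : Submodule ℤ V) (hML : M ≤ L)
    (hprim : ∀ x ∈ L, ∀ c : ℤ, c ≠ 0 → c • x ∈ M → x ∈ M)
    (hMnd : ∀ x ∈ span ℚ (M : Set V),
      (∀ y ∈ span ℚ (M : Set V), Φ x y = 0) → x = 0)
    (e : discGroup Φ M ≃+ discGroup Φ (perpLat Φ L M))
    (he : ∀ (x : dualLat Φ M) (y : dualLat Φ (perpLat Φ L M)),
      (x : V) + (y : V) ∈ L → e (discMk Φ M x) = discMk Φ (perpLat Φ L M) y)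
    (g : V ≃ₗ[ℚ] V)
    (hgM : (g : V → V) '' (M : Set V) = (M : Set V))
    (hgP : (g : V → V) '' ((perpLat Φ L M : Submodule ℤ V) : Set V) =
      ((perpLat Φ L M : Submodule ℤ V) : Set V))
    (hgΦ : ∀ x y : V, Φ (g x) (g y) = Φ x y) :
    (g : V → V) '' (L : Set V) = (L : Set V) ↔
      ∀ (x : dualLat Φ M) (hgx : g (x : V) ∈ dualLat Φ M)
        (y : dualLat Φ (perpLat Φ L M))
        (hgy : g (y : V) ∈ dualLat Φ (perpLat Φ L M)),
        e (discMk Φ M x) = discMk Φ (perpLat Φ L M) y →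
        e (discMk Φ M ⟨g (x : V), hgx⟩) = discMk Φ (perpLat Φ L M) ⟨g (y : V), hgy⟩ := by
  have hglue : ∀ (x : dualLat Φ M) (y : dualLat Φ (perpLat Φ L M)),
      e (discMk Φ M x) = discMk Φ (perpLat Φ L M) y → (x : V) + (y : V) ∈ L := by
    intro x y hxy
    obtain ⟨y', hy', hxy'⟩ := exists_dualLat_perpLat_add_mem Φ hsymm hnd hfg hspan hunimod hML
      hprim x.2
    have h : discMk Φ (perpLat Φ L M) y = discMk Φ (perpLat Φ L M) ⟨y', hy'⟩ :=
      hxy.symm.trans (he x ⟨y', hy'⟩ hxy')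
    have hsub : (y : V) - y' ∈ perpLat Φ L M :=
      (Submodule.Quotient.eq ((perpLat Φ L M).comap (dualLat Φ _).subtype)).mp h
    have : (x : V) + y = (x + y') + (y - y') := by abel
    rw [this]
    exact L.add_mem hxy' hsub.1
  constructor
  · intro hgL x hgx y hgy hxy
    refine he _ _ ?_
    rw [← map_add]
    have : g ((x : V) + y) ∈ (g : V → V) '' (L : Set V) := ⟨_, hglue x y hxy, rfl⟩
    rwa [hgL] at this
  · intro h
    have hmaps : ∀ l ∈ L, g l ∈ L := by
      intro l hl
      obtain ⟨x, hx, y, hy, rfl⟩ := exists_dualLat_add_dualLat Φ hsymm hspan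
        (fun x hx => (hunimod x).mpr hx) hML hMnd hl
      rw [map_add]
      exact hglue _ _ (h ⟨x, hx⟩ (map_mem_dualLat Φ g hgM hgΦ hx) ⟨y, hy⟩
        (map_mem_dualLat Φ g hgP hgΦ hy) (he ⟨x, hx⟩ ⟨y, hy⟩ hl))
    refine Set.Subset.antisymm (Set.image_subset_iff.mpr hmaps) fun l hl => ?_
    refine ⟨g.symm l, (hunimod _).mp fun y hy => ?_, g.apply_symm_apply l⟩
    rw [← hgΦ, g.apply_symm_apply]
    exact (hunimod l).mpr hl _ (hmaps y hy)
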